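/- Let G be a simple graph with maximum degree Δ containing no 5-cycle, and let M be a matching of G whose edges are pairwise at distance at least 5. Then any precolouring of M from {1, …, Δ + 1} extends to a proper (Δ + 1)-edge-colouring of G. -/

import Mathlib

namespace SimpleGraph

variable {V : Type}

/-- Two distinct edges (as unordered pairs) share an endpoint. -/
def EdgeAdj (e f : Sym2 V) : Prop :=
  e ≠ f ∧ ∃ v, v ∈ e ∧ v ∈ f

/-- The distance between edges `e` and `f` is at least `d`: every path between
an endpoint of `e` and an endpoint of `f` has length at least `d`. -/
def EdgeDistGe (G : SimpleGraph V) (e f : Sym2 V) (d : ℕ) : Prop :=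
  ∀ u v, u ∈ e → v ∈ f → ∀ p : G.Walk u v, d ≤ p.length

/-- A matching of `G`: pairwise non-adjacent edges of `G`. -/
def IsMatchingSet (G : SimpleGraph V) (M : Set (Sym2 V)) : Prop :=
  M ⊆ G.edgeSet ∧ ∀ e ∈ M, ∀ f ∈ M, e ≠ f → ¬ EdgeAdj e f

/-- A proper edge-colouring of `G` (off a deleted set `D`) with colours from
`{1, …, k}`. -/
def IsProperEC (G : SimpleGraph V) (D : Set (Sym2 V)) (k : ℕ) (c : Sym2 V → ℕ) : Prop :=
  (∀ e ∈ G.edgeSet, e ∉ D → c e ∈ Finset.Icc 1 k) ∧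
    ∀ e ∈ G.edgeSet, ∀ f ∈ G.edgeSet, e ∉ D → f ∉ D → EdgeAdj e f → c e ≠ c f

end SimpleGraph

open SimpleGraph

namespace SimpleGraph

/-- The colour `a` of the palette `{1, …, k}` does not appear on the coloured edges at `v`. -/
def MissingAt {V : Type} (G : SimpleGraph V) (D : Set (Sym2 V)) (k : ℕ) (c : Sym2 V → ℕ) (v : V)
    (a : ℕ) : Prop :=
  a ∈ Finset.Icc 1 k ∧ ∀ w, G.Adj v w → s(v, w) ∉ D → c s(v, w) ≠ a

section Colouring

variable {V : Type} {G : SimpleGraph V} {D K M : Set (Sym2 V)} {k : ℕ} {c : Sym2 V → ℕ}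

theorem isProperEC_iff : G.IsProperEC D k c ↔
    (∀ v w, G.Adj v w → s(v, w) ∉ D → c s(v, w) ∈ Finset.Icc 1 k) ∧
      ∀ v x y, G.Adj v x → G.Adj v y → x ≠ y → s(v, x) ∉ D → s(v, y) ∉ D →
        c s(v, x) ≠ c s(v, y) := by
  constructor
  · rintro ⟨h₁, h₂⟩
    exact ⟨fun v w h hD => h₁ _ h hD, fun v x y hx hy hxy hxD hyD => h₂ _ hx _ hy hxD hyD
      ⟨mt Sym2.congr_right.1 hxy, v, Sym2.mem_mk_left v x, Sym2.mem_mk_left v y⟩⟩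
  · rintro ⟨h₁, h₂⟩
    refine ⟨fun e => Sym2.ind (fun v w h hD => h₁ v w h hD) e, ?_⟩
    rintro e he f hf heD hfD ⟨hne, v, hve, hvf⟩
    obtain ⟨x, rfl⟩ := hve
    obtain ⟨y, rfl⟩ := hvf
    exact h₂ v x y he hf (fun h => hne (by rw [h])) heD hfD

theorem IsProperEC.mono {D' : Set (Sym2 V)} (hc : G.IsProperEC D k c) (h : D ⊆ D') :
    G.IsProperEC D' k c :=
  ⟨fun e he hD => hc.1 e he fun h' => hD (h h'), fun e he f hf heD hfD =>
    hc.2 e he f hf (fun h' => heD (h h')) fun h' => hfD (h h')⟩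

theorem MissingAt.mono {D' : Set (Sym2 V)} {v : V} {a : ℕ} (ha : G.MissingAt D k c v a)
    (h : D ⊆ D') : G.MissingAt D' k c v a :=
  ⟨ha.1, fun w hw hD => ha.2 w hw fun h' => hD (h h')⟩

/-- An uncoloured edge may receive a colour that is missing at both of its ends. -/
theorem IsProperEC.colour_edge [DecidableEq V] {y z : V} {a : ℕ} (hc : G.IsProperEC D k c)
    (hz : G.MissingAt D k c z a) (hy : G.MissingAt D k c y a) :
    G.IsProperEC (D \ {s(z, y)}) k (Function.update c s(z, y) a) := by
  have key : ∀ v x w, G.Adj v x → G.Adj v w → x ≠ w → s(v, x) = s(z, y) →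
      s(v, w) ∉ D \ {s(z, y)} → c s(v, w) ≠ a := by
    intro v x w hx hw hxw he hwD
    have hne : s(v, w) ≠ s(z, y) := by
      rw [← he]; exact mt Sym2.congr_right.1 hxw.symm
    have hD : s(v, w) ∉ D := fun h => hwD ⟨h, hne⟩
    rcases Sym2.eq_iff.1 he with ⟨rfl, rfl⟩ | ⟨rfl, rfl⟩
    · exact hz.2 w hw hD
    · exact hy.2 w hw hD
  rw [isProperEC_iff] at hc ⊢
  constructor
  · intro v w hvw hD
    by_cases h : s(v, w) = s(z, y)
    · rw [h, Function.update_self]; exact hz.1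
    · rw [Function.update_of_ne h]; exact hc.1 v w hvw fun h' => hD ⟨h', h⟩
  · intro v x w hx hw hxw hxD hwD
    by_cases h₁ : s(v, x) = s(z, y)
    · have h₂ : s(v, w) ≠ s(z, y) := by rw [← h₁]; exact mt Sym2.congr_right.1 hxw.symm
      rw [Function.update_of_ne h₂, h₁, Function.update_self]
      exact (key v x w hx hw hxw h₁ hwD).symm
    · rw [Function.update_of_ne h₁]
      by_cases h₂ : s(v, w) = s(z, y)
      · rw [h₂, Function.update_self]
        exact key v w x hw hx hxw.symm h₂ hxD
      · rw [Function.update_of_ne h₂]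
        exact hc.2 v x w hx hw hxw (fun h => hxD ⟨h, h₁⟩) fun h => hwD ⟨h, h₂⟩

/-- The step relation of fans centred at `z`: the edge `zx'` carries a colour missing at `x`. -/
def FanStep (G : SimpleGraph V) (D : Set (Sym2 V)) (k : ℕ) (c : Sym2 V → ℕ) (z x x' : V) : Prop :=
  G.Adj z x' ∧ s(z, x') ∉ D ∧ G.MissingAt D k c x (c s(z, x'))

theorem adj_of_mem_of_isChain {z : V} (l : List V) :
    ∀ y, (y :: l).IsChain (G.FanStep D k c z) → ∀ q ∈ l, G.Adj z q := by
  induction l with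
  | nil => simp
  | cons p l ih =>
    intro y h q hq
    rw [List.isChain_cons_cons] at h
    rcases List.mem_cons.1 hq with rfl | hq
    · exact h.1.1
    · exact ih p h.2 q hq

/-- Rotating a fan along a path of distinct vertices. -/
theorem exists_rotation_of_isChain [DecidableEq V] {z : V} (l : List V) :
    ∀ (D : Set (Sym2 V)) (c : Sym2 V → ℕ) (y x : V), G.IsProperEC D k c → G.Adj z y →
      s(z, y) ∈ D → (y :: l).IsChain (G.FanStep D k c z) → (y :: l).Nodup →
      (y :: l).getLast (List.cons_ne_nil _ _) = x →
      ∃ c', G.IsProperEC (insert s(z, x) (D \ {s(z, y)})) k c' ∧ (∀ f, z ∉ f → c' f = c f) ∧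
        ∀ a, G.MissingAt D k c z a → G.MissingAt D k c x a →
          G.MissingAt (insert s(z, x) (D \ {s(z, y)})) k c' z a ∧
          G.MissingAt (insert s(z, x) (D \ {s(z, y)})) k c' x a := by
  induction l with
  | nil =>
    intro D c y x hc hzy hyD _ _ hx
    obtain rfl : y = x := by simpa using hx
    have : insert s(z, y) (D \ {s(z, y)}) = D := by simp [hyD]
    rw [this]
    exact ⟨c, hc, fun _ _ => rfl, fun a h₁ h₂ => ⟨h₁, h₂⟩⟩
  | cons p l ih =>
    intro D c y x hc hzy hyD hch hnd hx
    rw [List.isChain_cons_cons] at hch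
    obtain ⟨⟨hzp, hpD, hmiss⟩, hch⟩ := hch
    obtain ⟨hynot, hnd'⟩ := List.nodup_cons.1 hnd
    have hyp : y ≠ p := fun h => hynot (h ▸ List.mem_cons_self)
    have hne : s(z, y) ≠ s(z, p) := mt Sym2.congr_right.1 hyp
    have hc' := isProperEC_iff.1 hc
    set D₁ := insert s(z, p) D \ {s(z, y)} with hD₁
    set c₁ := Function.update c s(z, y) (c s(z, p)) with hc₁
    have hp : G.IsProperEC D₁ k c₁ := by
      apply (hc.mono (Set.subset_insert s(z, p) D)).colour_edge
      · refine ⟨hc'.1 z p hzp hpD, fun w hw hwD => ?_⟩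
        simp only [Set.mem_insert_iff, not_or] at hwD
        exact hc'.2 z w p hw hzp (fun h => hwD.1 (by rw [h])) hwD.2 hpD
      · exact hmiss.mono (Set.subset_insert _ _)
    have hkeep : ∀ q a, q ≠ z → q ≠ y → G.MissingAt D k c q a → G.MissingAt D₁ k c₁ q a := by
      intro q a hqz hqy hq
      refine ⟨hq.1, fun w hw hwD => ?_⟩
      have h₁ : s(q, w) ≠ s(z, y) := by
        intro h
        rcases Sym2.eq_iff.1 h with ⟨h, _⟩ | ⟨h, _⟩
        · exact hqz h
        · exact hqy h
      rw [hc₁, Function.update_of_ne h₁]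
      exact hq.2 w hw fun h => hwD ⟨Set.mem_insert_of_mem _ h, h₁⟩
    have hadj : ∀ q ∈ p :: l, G.Adj z q := by
      intro q hq
      rcases List.mem_cons.1 hq with rfl | hq
      · exact hzp
      · exact adj_of_mem_of_isChain l _ hch q hq
    obtain ⟨c', h₁, h₂, h₃⟩ := ih D₁ c₁ p x hp hzp ⟨Set.mem_insert _ _, hne.symm⟩ (by
      refine List.IsChain.imp_of_mem_tail_imp ?_ hch
      rintro q w hq hw ⟨hzw, hwD, hqw⟩
      have hwp : w ≠ p := fun h => (List.nodup_cons.1 hnd').1 (h ▸ hw)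
      have hwy : w ≠ y := fun h => hynot (h ▸ List.mem_of_mem_tail hw)
      refine ⟨hzw, fun h => ?_, ?_⟩
      · rcases h.1 with h | h
        · exact hwp (Sym2.congr_right.1 h)
        · exact hwD h
      · rw [hc₁, Function.update_of_ne (mt Sym2.congr_right.1 hwy)]
        exact hkeep q _ (hadj q hq).ne' (fun h => hynot (h ▸ hq)) hqw) hnd' (by simpa using hx)
    have hDD : D₁ \ {s(z, p)} = D \ {s(z, y)} := by
      ext f
      simp only [hD₁, Set.mem_sdiff, Set.mem_insert_iff, Set.mem_singleton_iff]
      constructor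
      · tauto
      · rintro ⟨h, h'⟩
        exact ⟨⟨Or.inr h, h'⟩, fun h'' => hpD (h'' ▸ h)⟩
    rw [hDD] at h₁ h₃
    refine ⟨c', h₁, fun f hf => ?_, fun a hza hxa => h₃ a ?_ ?_⟩
    · rw [h₂ f hf, hc₁, Function.update_of_ne]
      rintro rfl
      simp at hf
    · refine ⟨hza.1, fun w hw hwD => ?_⟩
      by_cases h : s(z, w) = s(z, y)
      · rw [h, hc₁, Function.update_self]
        exact hza.2 p hzp hpD
      · rw [hc₁, Function.update_of_ne h]
        exact hza.2 w hw fun h' => hwD ⟨Set.mem_insert_of_mem _ h', h⟩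
    · have hxl : x ∈ p :: l := by
        rw [← hx, List.getLast_cons (List.cons_ne_nil _ _)]
        exact List.getLast_mem _
      exact hkeep x a (hadj x hxl).ne' (fun h => hynot (h ▸ hxl)) hxa

theorem exists_nodup_isChain {α : Type*} {r : α → α → Prop} {y x : α}
    (h : Relation.ReflTransGen r y x) :
    ∃ l : List α, (y :: l).IsChain r ∧ (y :: l).Nodup ∧
      (y :: l).getLast (List.cons_ne_nil _ _) = x := by
  induction h using Relation.ReflTransGen.head_induction_on with
  | refl => exact ⟨[], by simp, by simp, by simp⟩
  | @head a b hab _ ih =>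
    obtain ⟨l, h₁, h₂, h₃⟩ := ih
    by_cases ha : a ∈ b :: l
    · obtain ⟨s, t, hst⟩ := List.append_of_mem ha
      have hsuf : (a :: t) <:+ (b :: l) := ⟨s, hst.symm⟩
      refine ⟨t, h₁.suffix hsuf, h₂.sublist hsuf.sublist, ?_⟩
      rw [← h₃]
      simp [hst]
    · refine ⟨b :: l, ?_, ?_, ?_⟩
      · rw [List.isChain_cons_cons]; exact ⟨hab, h₁⟩
      · exact List.nodup_cons.2 ⟨ha, h₂⟩
      · rw [List.getLast_cons (List.cons_ne_nil _ _), h₃]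

/-- In a connected graph of maximum degree at most two there are at most two vertices of degree
at most one. -/
theorem Connected.false_of_three_degree_le_one {W : Type*} [Fintype W] [DecidableEq W]
    {H : SimpleGraph W} [DecidableRel H.Adj] (hH : H.Connected) (h₂ : ∀ v, H.degree v ≤ 2)
    {x₁ x₂ x₃ : W} (h₁₂ : x₁ ≠ x₂) (h₁₃ : x₁ ≠ x₃) (h₂₃ : x₂ ≠ x₃) (hx₁ : H.degree x₁ ≤ 1)
    (hx₂ : H.degree x₂ ≤ 1) (hx₃ : H.degree x₃ ≤ 1) : False := by
  have hcard := hH.card_vert_le_card_edgeSet_add_one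
  rw [Nat.card_eq_fintype_card, Nat.card_eq_fintype_card, ← edgeFinset_card] at hcard
  have hsum := H.sum_degrees_eq_twice_card_edges
  have hle : ∑ v, (H.degree v + if v ∈ ({x₁, x₂, x₃} : Finset W) then 1 else 0) ≤ ∑ _v : W, 2 := by
    refine Finset.sum_le_sum fun v _ => ?_
    split_ifs with h
    · simp only [Finset.mem_insert, Finset.mem_singleton] at h
      rcases h with rfl | rfl | rfl <;> omega
    · exact h₂ v
  rw [Finset.sum_add_distrib, hsum, Finset.sum_ite_mem, Finset.univ_inter, Finset.sum_const,
    Finset.sum_const, Finset.card_eq_three.2 ⟨x₁, x₂, x₃, h₁₂, h₁₃, h₂₃, rfl⟩,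
    Finset.card_univ] at hle
  simp only [smul_eq_mul] at hle
  omega

/-- The graph of the coloured edges with colour `α` or `β`. -/
def kempeGraph {V : Type} (G : SimpleGraph V) (D : Set (Sym2 V)) (c : Sym2 V → ℕ) (α β : ℕ) :
    SimpleGraph V where
  Adj v w := G.Adj v w ∧ s(v, w) ∉ D ∧ (c s(v, w) = α ∨ c s(v, w) = β)
  symm := ⟨fun v w ⟨h₁, h₂, h₃⟩ => by
    rw [Sym2.eq_swap] at h₂ h₃
    exact ⟨h₁.symm, h₂, h₃⟩⟩
  loopless := ⟨fun v h => h.1.ne rfl⟩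

theorem IsProperEC.false_of_three_ends [Fintype V] (hc : G.IsProperEC D k c) {α β : ℕ}
    {x₁ x₂ x₃ : V} (h₁₂ : x₁ ≠ x₂) (h₁₃ : x₁ ≠ x₃) (h₂₃ : x₂ ≠ x₃)
    (hx : ∀ x ∈ ({x₁, x₂, x₃} : Set V), G.MissingAt D k c x α ∨ G.MissingAt D k c x β)
    (hr₂ : (G.kempeGraph D c α β).Reachable x₁ x₂) (hr₃ : (G.kempeGraph D c α β).Reachable x₁ x₃) :
    False := by
  classical
  set H := G.kempeGraph D c α β with hH
  set C := H.connectedComponentMk x₁ with hC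
  have hinj : ∀ v : C, Set.InjOn (fun w : C => c s((v : V), (w : V)))
      (C.toSimpleGraph.neighborFinset v : Set C) := by
    intro v w hw w' hw' h
    simp only [Finset.mem_coe, mem_neighborFinset] at hw hw'
    by_contra hne
    exact (isProperEC_iff.1 hc).2 v w w' hw.1 hw'.1 (fun h' => hne (Subtype.ext h')) hw.2.1
      hw'.2.1 h
  have hdeg : ∀ v : C, C.toSimpleGraph.degree v ≤ 2 := by
    intro v
    refine (Finset.card_le_card_of_injOn (t := {α, β}) _ ?_ (hinj v)).trans Finset.card_le_two
    intro w hw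
    simp only [Finset.mem_coe, mem_neighborFinset] at hw
    simpa using hw.2.2
  have hone : ∀ v : C, (v : V) ∈ ({x₁, x₂, x₃} : Set V) → C.toSimpleGraph.degree v ≤ 1 := by
    intro v hv
    rcases hx v hv with h | h
    · refine (Finset.card_le_card_of_injOn (t := {β}) _ ?_ (hinj v)).trans_eq
        (Finset.card_singleton _)
      intro w hw
      simp only [Finset.mem_coe, mem_neighborFinset] at hw
      simpa using hw.2.2.resolve_left (h.2 w hw.1 hw.2.1)
    · refine (Finset.card_le_card_of_injOn (t := {α}) _ ?_ (hinj v)).trans_eq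
        (Finset.card_singleton _)
      intro w hw
      simp only [Finset.mem_coe, mem_neighborFinset] at hw
      simpa using hw.2.2.resolve_right (h.2 w hw.1 hw.2.1)
  have hm₁ : x₁ ∈ C := rfl
  have hm₂ : x₂ ∈ C := ConnectedComponent.sound hr₂.symm
  have hm₃ : x₃ ∈ C := ConnectedComponent.sound hr₃.symm
  refine C.connected_toSimpleGraph.false_of_three_degree_le_one hdeg
    (x₁ := ⟨x₁, hm₁⟩) (x₂ := ⟨x₂, hm₂⟩) (x₃ := ⟨x₃, hm₃⟩) ?_ ?_ ?_
    (hone _ (by simp)) (hone _ (by simp)) (hone _ (by simp))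
  · exact fun h => h₁₂ (congrArg Subtype.val h)
  · exact fun h => h₁₃ (congrArg Subtype.val h)
  · exact fun h => h₂₃ (congrArg Subtype.val h)

/-- Interchanging the colours `α` and `β` on the Kempe chain through `x`. -/
theorem IsProperEC.exists_kempe_swap (hc : G.IsProperEC D k c) {α β : ℕ}
    (hα : α ∈ Finset.Icc 1 k) (hβ : β ∈ Finset.Icc 1 k) (x : V) :
    ∃ c', G.IsProperEC D k c' ∧
      (∀ v w, G.Adj v w → s(v, w) ∉ D → (G.kempeGraph D c α β).Reachable x v →
        c' s(v, w) = Equiv.swap α β (c s(v, w))) ∧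
      ∀ v w, G.Adj v w → s(v, w) ∉ D → ¬ (G.kempeGraph D c α β).Reachable x v →
        c' s(v, w) = c s(v, w) := by
  classical
  set H := G.kempeGraph D c α β with hH
  set c' : Sym2 V → ℕ := fun f =>
    if ∃ v ∈ f, H.Reachable x v then Equiv.swap α β (c f) else c f with hc'
  have hswap : ∀ v w, G.Adj v w → s(v, w) ∉ D → H.Reachable x v →
      c' s(v, w) = Equiv.swap α β (c s(v, w)) := by
    intro v w _ _ hv
    exact if_pos ⟨v, Sym2.mem_mk_left v w, hv⟩
  have hkeep : ∀ v w, G.Adj v w → s(v, w) ∉ D → ¬ H.Reachable x v →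
      c' s(v, w) = c s(v, w) := by
    intro v w hvw hD hv
    by_cases h : ∃ u ∈ s(v, w), H.Reachable x u
    · obtain ⟨u, hu, hxu⟩ := h
      rcases Sym2.mem_iff.1 hu with rfl | rfl
      · exact absurd hxu hv
      · have hcol : ¬ (c s(v, u) = α ∨ c s(v, u) = β) := fun h =>
          hv (hxu.trans (Adj.reachable (⟨hvw, hD, h⟩ : H.Adj v u)).symm)
        rw [not_or] at hcol
        rw [hc']
        simp only
        rw [if_pos ⟨u, hu, hxu⟩, Equiv.swap_apply_of_ne_of_ne hcol.1 hcol.2]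
    · exact if_neg h
  refine ⟨c', ?_, hswap, hkeep⟩
  have hp := isProperEC_iff.1 hc
  rw [isProperEC_iff]
  constructor
  · intro v w hvw hD
    by_cases hv : H.Reachable x v
    · rw [hswap v w hvw hD hv, Equiv.swap_apply_def]
      split_ifs
      · exact hβ
      · exact hα
      · exact hp.1 v w hvw hD
    · rw [hkeep v w hvw hD hv]
      exact hp.1 v w hvw hD
  · intro v y w hy hw hyw hyD hwD
    by_cases hv : H.Reachable x v
    · rw [hswap v y hy hyD hv, hswap v w hw hwD hv]
      exact (Equiv.swap α β).injective.ne (hp.2 v y w hy hw hyw hyD hwD)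
    · rw [hkeep v y hy hyD hv, hkeep v w hw hwD hv]
      exact hp.2 v y w hy hw hyw hyD hwD

/-- If a colour is missing at the centre of a fan and at one of its vertices, then the first edge
of the fan can be coloured. -/
theorem IsProperEC.exists_colouring_of_fan {y z x : V} {α : ℕ}
    (hc : G.IsProperEC D k c) (hzy : G.Adj z y) (hyD : s(z, y) ∈ D)
    (hx : Relation.ReflTransGen (G.FanStep D k c z) y x) (hzα : G.MissingAt D k c z α)
    (hxα : G.MissingAt D k c x α) : ∃ c', G.IsProperEC (D \ {s(z, y)}) k c' := by
  classical
  obtain ⟨l, h₁, h₂, h₃⟩ := exists_nodup_isChain hx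
  obtain ⟨c', hc', -, hmiss⟩ := exists_rotation_of_isChain l D c y x hc hzy hyD h₁ h₂ h₃
  obtain ⟨hz, hx'⟩ := hmiss α hzα hxα
  refine ⟨_, (hc'.colour_edge hz hx').mono ?_⟩
  rintro f ⟨hf, hf'⟩
  exact hf.resolve_left hf'

/-- **Vizing's fan argument.** Either the edge `zy` can be coloured, or the fan centred at `z` can
be rotated so that the uncoloured edge becomes an edge `zw` with no colour missing at `w`. -/
theorem IsProperEC.exists_colouring_or_rotation [Fintype V] {y z : V} (hc : G.IsProperEC D k c)
    (hzy : G.Adj z y) (hyD : s(z, y) ∈ D) (hz : ∃ α, G.MissingAt D k c z α)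
    (hy : ∃ α, G.MissingAt D k c y α) :
    (∃ c', G.IsProperEC (D \ {s(z, y)}) k c') ∨
      ∃ w, G.Adj z w ∧ s(z, w) ∉ D ∧ (∀ a, ¬ G.MissingAt D k c w a) ∧
        ∃ c', G.IsProperEC (insert s(z, w) (D \ {s(z, y)})) k c' ∧ ∀ f, z ∉ f → c' f = c f := by
  classical
  have hp := isProperEC_iff.1 hc
  set R := Relation.ReflTransGen (G.FanStep D k c z) y with hR
  have hRadj : ∀ x, R x → G.Adj z x := by
    intro x hx
    rcases Relation.ReflTransGen.cases_tail hx with rfl | ⟨_, _, h⟩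
    · exact hzy
    · exact h.1
  by_cases hfull : ∃ w, R w ∧ ∀ a, ¬ G.MissingAt D k c w a
  · right
    obtain ⟨w, hw, hwf⟩ := hfull
    rcases Relation.ReflTransGen.cases_tail hw with rfl | ⟨_, _, h⟩
    · exact absurd hy (not_exists.2 hwf)
    · obtain ⟨l, h₁, h₂, h₃⟩ := exists_nodup_isChain hw
      obtain ⟨c', hc', hkeep, -⟩ := exists_rotation_of_isChain l D c y w hc hzy hyD h₁ h₂ h₃
      exact ⟨w, h.1, h.2.1, hwf, c', hc', hkeep⟩
  left
  push Not at hfull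
  by_cases hcommon : ∃ x a, R x ∧ G.MissingAt D k c z a ∧ G.MissingAt D k c x a
  · obtain ⟨x, a, hx, hza, hxa⟩ := hcommon
    exact hc.exists_colouring_of_fan hzy hyD hx hza hxa
  push Not at hcommon
  choose! m hm using hfull
  have hnext : ∀ x, R x → ∃ x', R x' ∧ x' ≠ y ∧ G.Adj z x' ∧ s(z, x') ∉ D ∧
      c s(z, x') = m x := by
    intro x hx
    have hne : ¬ G.MissingAt D k c z (m x) := fun h => hcommon x _ hx h (hm x hx)
    have : ∃ x', G.Adj z x' ∧ s(z, x') ∉ D ∧ c s(z, x') = m x := by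
      by_contra hcon
      push Not at hcon
      exact hne ⟨(hm x hx).1, hcon⟩
    obtain ⟨x', h₁, h₂, h₃⟩ := this
    refine ⟨x', hx.tail ⟨h₁, h₂, h₃ ▸ hm x hx⟩, ?_, h₁, h₂, h₃⟩
    rintro rfl
    exact h₂ hyD
  choose! g hgR hgy hgadj hgD hgm using hnext
  obtain ⟨x₁, hx₁, x₂, hx₂, hne, hg⟩ : ∃ x₁ ∈ Finset.univ.filter R, ∃ x₂ ∈ Finset.univ.filter R,
      x₁ ≠ x₂ ∧ g x₁ = g x₂ := by
    refine Finset.exists_ne_map_eq_of_card_lt_of_maps_to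
      (t := (Finset.univ.filter R).erase y) (Finset.card_erase_lt_of_mem ?_) ?_
    · simpa using (Relation.ReflTransGen.refl : R y)
    · intro x hx
      simp only [Finset.coe_filter, Finset.mem_univ, true_and, Set.mem_ofPred_eq] at hx
      simp [hgR x hx, hgy x hx]
  simp only [Finset.mem_filter, Finset.mem_univ, true_and] at hx₁ hx₂
  obtain ⟨α, hα⟩ := hz
  set β := m x₁ with hβ
  have hβ₁ : G.MissingAt D k c x₁ β := hm x₁ hx₁
  have hβ₂ : G.MissingAt D k c x₂ β := by
    rw [hβ, ← hgm x₁ hx₁, hg, hgm x₂ hx₂]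
    exact hm x₂ hx₂
  obtain ⟨x, hx, hxβ, hxz⟩ : ∃ x, R x ∧ G.MissingAt D k c x β ∧
      ¬ (G.kempeGraph D c α β).Reachable x z := by
    by_contra hcon
    push Not at hcon
    refine hc.false_of_three_ends (α := α) (β := β) (hRadj x₁ hx₁).ne (hRadj x₂ hx₂).ne hne ?_
      (hcon x₁ hx₁ hβ₁).symm (hcon x₂ hx₂ hβ₂).symm
    rintro v (rfl | rfl | rfl)
    · exact Or.inl hα
    · exact Or.inr hβ₁
    · exact Or.inr hβ₂
  obtain ⟨c', hc', hswap, hkeep⟩ := hc.exists_kempe_swap hα.1 hβ₁.1 x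
  have hzα : G.MissingAt D k c' z α :=
    ⟨hα.1, fun w hw hwD => by rw [hkeep z w hw hwD hxz]; exact hα.2 w hw hwD⟩
  have hαβ : ∀ v, (G.kempeGraph D c α β).Reachable x v → G.MissingAt D k c v β →
      G.MissingAt D k c' v α := by
    intro v hv hvβ
    refine ⟨hα.1, fun w hw hwD h => hvβ.2 w hw hwD ?_⟩
    rw [hswap v w hw hwD hv] at h
    rwa [Equiv.swap_apply_eq_iff, Equiv.swap_apply_left] at h
  have hreach : ∀ v, R v → (∃ v', Relation.ReflTransGen (G.FanStep D k c' z) y v' ∧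
      G.MissingAt D k c' v' α) ∨ Relation.ReflTransGen (G.FanStep D k c' z) y v := by
    intro v hv
    induction hv with
    | refl => exact Or.inr Relation.ReflTransGen.refl
    | @tail p q _ hpq ih =>
      rcases ih with ih | ih
      · exact Or.inl ih
      by_cases hpx : (G.kempeGraph D c α β).Reachable x p
      · by_cases hcβ : c s(z, q) = β
        · exact Or.inl ⟨p, ih, hαβ p hpx (hcβ ▸ hpq.2.2)⟩
        · refine Or.inr (ih.tail ⟨hpq.1, hpq.2.1, ?_⟩)
          rw [hkeep z q hpq.1 hpq.2.1 hxz]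
          refine ⟨hpq.2.2.1, fun w hw hwD h => hpq.2.2.2 w hw hwD ?_⟩
          rw [hswap p w hw hwD hpx] at h
          rw [← Equiv.swap_apply_of_ne_of_ne (hα.2 q hpq.1 hpq.2.1) hcβ, ← h,
            Equiv.swap_apply_self]
      · refine Or.inr (ih.tail ⟨hpq.1, hpq.2.1, ?_⟩)
        rw [hkeep z q hpq.1 hpq.2.1 hxz]
        exact ⟨hpq.2.2.1, fun w hw hwD => by
          rw [hkeep p w hw hwD hpx]; exact hpq.2.2.2 w hw hwD⟩
  obtain ⟨v', hv', hv'α⟩ : ∃ v', Relation.ReflTransGen (G.FanStep D k c' z) y v' ∧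
      G.MissingAt D k c' v' α := by
    rcases hreach x hx with h | h
    · exact h
    · exact ⟨x, h, hαβ x (Reachable.refl x) hxβ⟩
  exact hc'.exists_colouring_of_fan hzy hyD hv' hzα hv'α

theorem exists_missingAt [Fintype V] [DecidableRel G.Adj] {v w : V} (c : Sym2 V → ℕ)
    (hv : G.degree v ≤ k) (hvw : G.Adj v w) (hD : s(v, w) ∈ D) :
    ∃ a, G.MissingAt D k c v a := by
  classical
  have hcard : (((G.neighborFinset v).erase w).image fun x => c s(v, x)).card <
      (Finset.Icc 1 k).card := by
    calc _ ≤ ((G.neighborFinset v).erase w).card := Finset.card_image_le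
      _ < (G.neighborFinset v).card := Finset.card_erase_lt_of_mem (by simpa)
      _ ≤ k := hv
      _ = _ := by simp
  obtain ⟨a, ha, ha'⟩ := Finset.exists_mem_notMem_of_card_lt_card hcard
  refine ⟨a, ha, fun x hx hxD h => ha' (Finset.mem_image.2 ⟨x, ?_, h⟩)⟩
  rw [Finset.mem_erase, mem_neighborFinset]
  refine ⟨?_, hx⟩
  rintro rfl
  exact hxD hD

theorem notMem_of_forall_not_missingAt [Fintype V] [DecidableRel G.Adj] {w : V}
    (hdeg : ∀ v, G.degree v ≤ k) (hD : D ⊆ G.edgeSet) (hw : ∀ a, ¬ G.MissingAt D k c w a) :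
    ∀ f ∈ D, w ∉ f := by
  rintro f hf ⟨x, rfl⟩
  exact not_exists.2 hw (exists_missingAt c (hdeg w) (hD hf) hf)

/-- If the ends of the edges in `K` form a vertex cover, then the remaining edges can be coloured
with as many colours as the maximum degree. -/
theorem exists_isProperEC_of_cover [Fintype V] [DecidableRel G.Adj]
    (hdeg : ∀ v, G.degree v ≤ k) (hK : K ⊆ G.edgeSet)
    (hcover : ∀ x y, G.Adj x y → ∃ f ∈ K, x ∈ f ∨ y ∈ f) : ∃ c, G.IsProperEC K k c := by
  classical
  obtain ⟨D, ⟨⟨hKD, hDE⟩, c, hc⟩, hmin⟩ := Set.exists_min_image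
    {D : Set (Sym2 V) | (K ⊆ D ∧ D ⊆ G.edgeSet) ∧ ∃ c, G.IsProperEC D k c} Set.ncard
    (Set.toFinite _) ⟨G.edgeSet, ⟨hK, subset_rfl⟩, fun _ => 0,
      fun e he he' => absurd he he', fun e he _ _ he' => absurd he he'⟩
  have hfan : ∀ (D' : Set (Sym2 V)) (c : Sym2 V → ℕ) (x y : V), K ⊆ D' → D' ⊆ G.edgeSet →
      D'.ncard = D.ncard → G.IsProperEC D' k c → s(x, y) ∈ D' → s(x, y) ∉ K →
      ∃ w, G.Adj x w ∧ s(x, w) ∉ D' ∧ (∀ f ∈ K, w ∉ f) ∧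
        ∃ c', G.IsProperEC (insert s(x, w) (D' \ {s(x, y)})) k c' := by
    intro D' c x y hKD hDE hcard hc hxy hxyK
    rcases hc.exists_colouring_or_rotation (hDE hxy) hxy
        (exists_missingAt c (hdeg x) (hDE hxy) hxy)
        (exists_missingAt c (hdeg y) (G.adj_symm (hDE hxy)) (by rwa [Sym2.eq_swap])) with
      h | ⟨w, h₁, h₂, h₃, c', h₄, -⟩
    · have h₁ := hmin _ ⟨⟨Set.subset_sdiff_singleton hKD hxyK, Set.sdiff_subset.trans hDE⟩, h⟩
      have h₂ := Set.ncard_sdiff_singleton_lt_of_mem hxy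
      omega
    · exact ⟨w, h₁, h₂, fun f hf =>
        notMem_of_forall_not_missingAt hdeg hDE h₃ f (hKD hf), c', h₄⟩
  suffices h : D ⊆ K by
    rw [hKD.antisymm h]
    exact ⟨c, hc⟩
  intro f hf
  by_contra hfK
  induction f with | _ x y
  obtain ⟨w, hxw, hxwD, hwK, c', hc'⟩ := hfan D c x y hKD hDE rfl hc hf hfK
  have hwx : s(x, w) = s(w, x) := Sym2.eq_swap
  obtain ⟨w', hww', -, hw'K, -⟩ := hfan (insert s(x, w) (D \ {s(x, y)})) c' w x
    ((Set.subset_sdiff_singleton hKD hfK).trans (Set.subset_insert _ _))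
    (Set.insert_subset hxw (Set.sdiff_subset.trans hDE))
    (by rw [Set.ncard_insert_of_notMem fun h => hxwD h.1, Set.ncard_sdiff_singleton_add_one hf])
    hc' (hwx ▸ Set.mem_insert _ _) fun h => hxwD (hwx ▸ hKD h)
  obtain ⟨f, hf, h | h⟩ := hcover w w' hww'
  · exact hwK f hf h
  · exact hw'K f hf h

theorem IsMatchingSet.eq_of_mem {e f : Sym2 V} {v : V} (hK : G.IsMatchingSet K) (he : e ∈ K)
    (hf : f ∈ K) (hve : v ∈ e) (hvf : v ∈ f) : e = f := by
  by_contra h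
  exact hK.2 e he f hf h ⟨h, v, hve, hvf⟩

theorem IsMatchingSet.subset {K' : Set (Sym2 V)} (hK : G.IsMatchingSet K) (h : K' ⊆ K) :
    G.IsMatchingSet K' :=
  ⟨h.trans hK.1, fun e he f hf => hK.2 e (h he) f (h hf)⟩

theorem IsMatchingSet.insert {x y : V} (hK : G.IsMatchingSet K) (hxy : G.Adj x y)
    (hx : ∀ f ∈ K, x ∉ f) (hy : ∀ f ∈ K, y ∉ f) : G.IsMatchingSet (insert s(x, y) K) := by
  have key : ∀ f ∈ K, ∀ v, v ∈ s(x, y) → v ∉ f := by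
    intro f hf v hv
    rcases Sym2.mem_iff.1 hv with rfl | rfl
    · exact hx f hf
    · exact hy f hf
  refine ⟨Set.insert_subset hxy hK.1, ?_⟩
  rintro e (rfl | he) f (rfl | hf) hne ⟨-, v, hve, hvf⟩
  · exact hne rfl
  · exact key f hf v hve hvf
  · exact key e he v hvf hve
  · exact hne (hK.eq_of_mem he hf hve hvf)

/-- `K` is a matching of minimum size among those that contain `M` and whose complement can be
properly coloured with colours from `{1, …, k}`, and `c` is such a colouring. -/
structure IsMinColouring (G : SimpleGraph V) (M K : Set (Sym2 V)) (k : ℕ) (c : Sym2 V → ℕ) :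
    Prop where
  isMatchingSet : G.IsMatchingSet K
  subset : M ⊆ K
  isProperEC : G.IsProperEC K k c
  ncard_le : ∀ K' c', G.IsMatchingSet K' → M ⊆ K' → G.IsProperEC K' k c' → K.ncard ≤ K'.ncard

theorem exists_isMinColouring [Fintype V] [DecidableRel G.Adj] (hdeg : ∀ v, G.degree v ≤ k)
    (hM : G.IsMatchingSet M) : ∃ K c, G.IsMinColouring M K k c := by
  obtain ⟨L, ⟨hL, hML⟩, hmax⟩ := Set.exists_max_image
    {K : Set (Sym2 V) | G.IsMatchingSet K ∧ M ⊆ K} Set.ncard (Set.toFinite _)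
    ⟨M, hM, subset_rfl⟩
  have hc : ∃ c, G.IsProperEC L k c := by
    refine exists_isProperEC_of_cover hdeg hL.1 fun x y hxy => ?_
    by_contra! h
    have h₁ := hmax _ ⟨hL.insert hxy (fun f hf => (h f hf).1) fun f hf => (h f hf).2,
      hML.trans (Set.subset_insert _ _)⟩
    rw [Set.ncard_insert_of_notMem fun h' => (h _ h').1 (Sym2.mem_mk_left x y)] at h₁
    omega
  obtain ⟨K, ⟨hK, hMK, c, hc⟩, hmin⟩ := Set.exists_min_image
    {K : Set (Sym2 V) | G.IsMatchingSet K ∧ M ⊆ K ∧ ∃ c, G.IsProperEC K k c} Set.ncard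
    (Set.toFinite _) ⟨L, hL, hML, hc⟩
  exact ⟨K, c, hK, hMK, hc, fun K' c' h₁ h₂ h₃ => hmin K' ⟨h₁, h₂, c', h₃⟩⟩

/-- No coloured edge at `u` of colour `a` leads to an end of an edge of `K`. -/
def GoodAt (G : SimpleGraph V) (K : Set (Sym2 V)) (c : Sym2 V → ℕ) (a : ℕ) (u : V) : Prop :=
  ∀ y, G.Adj u y → s(u, y) ∉ K → c s(u, y) = a → ∀ f ∈ K, y ∉ f

/-- Some coloured edge at `u` of colour `a` leads to a vertex that `K` does not cover. -/
def FreeAt (G : SimpleGraph V) (K : Set (Sym2 V)) (c : Sym2 V → ℕ) (a : ℕ) (u : V) : Prop :=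
  ∃ y, G.Adj u y ∧ s(u, y) ∉ K ∧ c s(u, y) = a ∧ ∀ f ∈ K, y ∉ f

theorem FreeAt.goodAt {a : ℕ} {u : V} (hc : G.IsProperEC K k c) (h : G.FreeAt K c a u) :
    G.GoodAt K c a u := by
  obtain ⟨y, h₁, h₂, h₃, h₄⟩ := h
  intro x hx hxK hxa
  obtain rfl : x = y := by
    by_contra hne
    exact (isProperEC_iff.1 hc).2 u x y hx h₁ hne hxK h₂ (hxa.trans h₃.symm)
  exact h₄

/-- A fan rotation frees a bad end `u` of an edge `uv` of `M`; without 5-cycles it keeps `v` free,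
and it is too local to affect the other edges of `M`. -/
theorem IsMinColouring.exists_freeAt [Fintype V] [DecidableRel G.Adj]
    (hdeg : ∀ v, G.degree v ≤ k)
    (hC5 : ¬ ∃ (v : V) (w : G.Walk v v), w.IsCycle ∧ w.length = 5)
    (hdist : ∀ e ∈ M, ∀ f ∈ M, e ≠ f → G.EdgeDistGe e f 5) (Φ : Sym2 V → ℕ)
    (h : G.IsMinColouring M K k c) {u v : V} (huv : s(u, v) ∈ M)
    (hbad : ¬ G.GoodAt K c (Φ s(u, v)) u) :
    ∃ K' c', G.IsMinColouring M K' k c' ∧ G.FreeAt K' c' (Φ s(u, v)) u ∧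
      (G.FreeAt K c (Φ s(u, v)) v → G.FreeAt K' c' (Φ s(u, v)) v) ∧
      ∀ f ∈ M, f ≠ s(u, v) → ∀ x ∈ f, G.GoodAt K c (Φ f) x → G.GoodAt K' c' (Φ f) x := by
  classical
  obtain ⟨hK, hMK, hc, hmin⟩ := h
  simp only [GoodAt, not_forall, not_not] at hbad
  obtain ⟨y, huy, huyK, huyΦ, g, hg, z, rfl⟩ := hbad
  have hyz : G.Adj y z := hK.1 hg
  have huvK := hMK huv
  have huvG : G.Adj u v := hK.1 huvK
  have hyv : y ≠ v := by
    rintro rfl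
    exact huyK huvK
  have hz : z ∉ s(u, v) := by
    intro hz
    have : y ∈ s(u, v) := hK.eq_of_mem huvK hg hz (Sym2.mem_mk_right y z) ▸ Sym2.mem_mk_left y z
    rcases Sym2.mem_iff.1 this with rfl | rfl
    · exact huy.ne rfl
    · exact hyv rfl
  have hyzM : s(y, z) ∉ M := by
    intro hM
    have := hdist _ huv _ hM (fun h => hz (h ▸ Sym2.mem_mk_right y z)) u y
      (Sym2.mem_mk_left u v) (Sym2.mem_mk_left y z) huy.toWalk
    simp at this
  rw [Sym2.mem_iff, not_or] at hz
  obtain ⟨hzu, hzv⟩ := hz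
  have hswap : s(z, y) = s(y, z) := Sym2.eq_swap
  rw [← hswap] at hg hyzM
  have hMK' := Set.subset_sdiff_singleton hMK hyzM
  have hzK : ∀ f ∈ K \ {s(z, y)}, z ∉ f := fun f hf hzf =>
    hf.2 (hK.eq_of_mem hf.1 hg hzf (Sym2.mem_mk_left z y))
  have hyK : ∀ f ∈ K \ {s(z, y)}, y ∉ f := fun f hf hyf =>
    hf.2 (hK.eq_of_mem hf.1 hg hyf (Sym2.mem_mk_right z y))
  rcases hc.exists_colouring_or_rotation hyz.symm hg (exists_missingAt c (hdeg z) hyz.symm hg)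
      (exists_missingAt c (hdeg y) hyz (by rwa [← hswap])) with
    ⟨c', hc'⟩ | ⟨w, hzw, hzwK, hwfull, c', hc', hkeep⟩
  · have h₁ := hmin _ _ (hK.subset Set.sdiff_subset) hMK' hc'
    have h₂ := Set.ncard_sdiff_singleton_lt_of_mem hg
    omega
  have hwK := notMem_of_forall_not_missingAt hdeg hK.1 hwfull
  have hwy : w ≠ y := by
    rintro rfl
    exact hwK _ hg (Sym2.mem_mk_right z w)
  refine ⟨_, c', ⟨(hK.subset Set.sdiff_subset).insert hzw hzK fun f hf => hwK f hf.1,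
    hMK'.trans (Set.subset_insert _ _), hc', fun K' c'' h₁ h₂ h₃ => ?_⟩, ?_, ?_, ?_⟩
  · rw [Set.ncard_insert_of_notMem fun h => hzwK h.1, Set.ncard_sdiff_singleton_add_one hg]
    exact hmin K' c'' h₁ h₂ h₃
  · have hzuy : z ∉ s(u, y) := by simp [hzu, hyz.ne']
    refine ⟨y, huy, ?_, (hkeep _ hzuy).trans huyΦ, ?_⟩
    · rintro (h | h)
      · exact hzuy (h ▸ Sym2.mem_mk_left z w)
      · exact huyK h.1
    · rintro f (rfl | hf)
      · simp [hyz.ne, hwy.symm]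
      · exact hyK f hf
  · rintro ⟨x, hvx, hvxK, hvxΦ, hxK⟩
    have hxz : z ≠ x := by
      rintro rfl
      exact hxK _ hg (Sym2.mem_mk_left z y)
    have hzvx : z ∉ s(v, x) := by simp [hzv, hxz]
    refine ⟨x, hvx, ?_, (hkeep _ hzvx).trans hvxΦ, ?_⟩
    · rintro (h | h)
      · exact hzvx (h ▸ Sym2.mem_mk_left z w)
      · exact hvxK h.1
    · rintro f (rfl | hf)
      · rw [Sym2.mem_iff, not_or]
        refine ⟨hxz.symm, ?_⟩
        rintro rfl
        have hxu : x ≠ u := by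
          rintro rfl
          exact hxK _ huvK (Sym2.mem_mk_left x v)
        refine hC5 ⟨u, .cons huy (.cons hyz (.cons hzw (.cons hvx.symm (.cons huvG.symm .nil)))),
          ?_, rfl⟩
        simp [Walk.cons_isCycle_iff, huy.ne, huy.ne', hyz.ne, hzw.ne, hvx.ne', huvG.ne, huvG.ne',
          hzu, hzv, hwy.symm, hyv, hxu, hxu.symm, Ne.symm hzu]
      · exact hxK f hf.1
  · rintro f hf hne x hxf hgood q hxq hxqK hxqΦ
    have hwalk : ∀ p : G.Walk u x, 5 ≤ p.length :=
      hdist _ huv f hf hne.symm u x (Sym2.mem_mk_left u v) hxf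
    have hzq : z ≠ q := by
      rintro rfl
      simpa using hwalk (.cons huy (.cons hyz (.cons hxq.symm .nil)))
    have hzx : z ≠ x := by
      rintro rfl
      simpa using hwalk (.cons huy (.cons hyz .nil))
    have hzxq : z ∉ s(x, q) := by simp [hzx, hzq]
    have hxqK' : s(x, q) ∉ K := by
      intro h
      refine hxqK (Or.inr ⟨h, fun h' => hzxq ?_⟩)
      rw [Set.mem_singleton_iff] at h'
      exact h' ▸ Sym2.mem_mk_left z y
    have hq := hgood q hxq hxqK' ((hkeep _ hzxq).symm.trans hxqΦ)
    rintro g (rfl | hg)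
    · rw [Sym2.mem_iff, not_or]
      refine ⟨hzq.symm, ?_⟩
      rintro rfl
      simpa using hwalk (.cons huy (.cons hyz (.cons hzw (.cons hxq.symm .nil))))
    · exact hq g hg.1

theorem IsMinColouring.exists_goodAt_of_mem [Fintype V] [DecidableRel G.Adj]
    (hdeg : ∀ v, G.degree v ≤ k)
    (hC5 : ¬ ∃ (v : V) (w : G.Walk v v), w.IsCycle ∧ w.length = 5)
    (hdist : ∀ e ∈ M, ∀ f ∈ M, e ≠ f → G.EdgeDistGe e f 5) (Φ : Sym2 V → ℕ)
    (h : G.IsMinColouring M K k c) {e : Sym2 V} (he : e ∈ M) :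
    ∃ K' c', G.IsMinColouring M K' k c' ∧ (∀ x ∈ e, G.GoodAt K' c' (Φ e) x) ∧
      ∀ f ∈ M, f ≠ e → ∀ x ∈ f, G.GoodAt K c (Φ f) x → G.GoodAt K' c' (Φ f) x := by
  by_cases hgood : ∀ x ∈ e, G.GoodAt K c (Φ e) x
  · exact ⟨K, c, h, hgood, fun _ _ _ _ _ h => h⟩
  push Not at hgood
  obtain ⟨u, ⟨v, rfl⟩, hu⟩ := hgood
  obtain ⟨K₁, c₁, h₁, hu₁, -, hpres₁⟩ := h.exists_freeAt hdeg hC5 hdist Φ he hu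
  by_cases hv : G.GoodAt K₁ c₁ (Φ s(u, v)) v
  · refine ⟨K₁, c₁, h₁, fun x hx => ?_, hpres₁⟩
    rcases Sym2.mem_iff.1 hx with rfl | rfl
    · exact hu₁.goodAt h₁.isProperEC
    · exact hv
  · have hswap : s(v, u) = s(u, v) := Sym2.eq_swap
    have hfree := h₁.exists_freeAt (u := v) (v := u) hdeg hC5 hdist Φ (by rwa [hswap])
      (by rwa [hswap])
    rw [hswap] at hfree
    obtain ⟨K₂, c₂, h₂, hv₂, hu₂, hpres₂⟩ := hfree
    refine ⟨K₂, c₂, h₂, fun x hx => ?_, fun f hf hne x hx hfx =>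
      hpres₂ f hf hne x hx (hpres₁ f hf hne x hx hfx)⟩
    rcases Sym2.mem_iff.1 hx with rfl | rfl
    · exact (hu₂ hu₁).goodAt h₂.isProperEC
    · exact hv₂.goodAt h₂.isProperEC

theorem exists_isMinColouring_goodAt [Fintype V] [DecidableRel G.Adj]
    (hdeg : ∀ v, G.degree v ≤ k)
    (hC5 : ¬ ∃ (v : V) (w : G.Walk v v), w.IsCycle ∧ w.length = 5) (hM : G.IsMatchingSet M)
    (hdist : ∀ e ∈ M, ∀ f ∈ M, e ≠ f → G.EdgeDistGe e f 5) (Φ : Sym2 V → ℕ) :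
    ∃ K c, G.IsMinColouring M K k c ∧ ∀ e ∈ M, ∀ x ∈ e, G.GoodAt K c (Φ e) x := by
  classical
  have key : ∀ s : Finset (Sym2 V), (∀ e ∈ s, e ∈ M) →
      ∃ K c, G.IsMinColouring M K k c ∧ ∀ e ∈ s, ∀ x ∈ e, G.GoodAt K c (Φ e) x := by
    intro s
    induction s using Finset.induction_on with
    | empty =>
      intro _
      obtain ⟨K, c, h⟩ := exists_isMinColouring hdeg hM
      exact ⟨K, c, h, by simp⟩
    | insert e s _ ih =>
      intro hs
      obtain ⟨K, c, h, hgood⟩ := ih fun e he => hs e (Finset.mem_insert_of_mem he)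
      obtain ⟨K', c', h', he, hpres⟩ :=
        h.exists_goodAt_of_mem hdeg hC5 hdist Φ (hs e (Finset.mem_insert_self e s))
      refine ⟨K', c', h', fun f hf x hx => ?_⟩
      by_cases hfe : f = e
      · exact hfe ▸ he x (hfe ▸ hx)
      · exact hpres f (hs f hf) hfe x hx (hgood f (Finset.mem_of_mem_insert_of_ne hf hfe) x hx)
  obtain ⟨K, c, h, hgood⟩ := key (Set.toFinite M).toFinset fun e => (Set.toFinite M).mem_toFinset.1
  exact ⟨K, c, h, fun e he => hgood e ((Set.toFinite M).mem_toFinset.2 he)⟩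

theorem exists_walk_length_le_one {g : Sym2 V} {u v : V} (hg : g ∈ G.edgeSet) (hu : u ∈ g)
    (hv : v ∈ g) : ∃ p : G.Walk u v, p.length ≤ 1 := by
  obtain ⟨x, rfl⟩ := hu
  rcases Sym2.mem_iff.1 hv with rfl | rfl
  · exact ⟨.nil, by simp⟩
  · exact ⟨.cons hg .nil, le_rfl⟩

/-- Recolouring `K` and the edges that clash with the precolouring with one additional colour. -/
theorem IsProperEC.exists_extension (hc : G.IsProperEC K k c) (hK : G.IsMatchingSet K)
    (hMK : M ⊆ K) (hdist : ∀ e ∈ M, ∀ f ∈ M, e ≠ f → G.EdgeDistGe e f 5) {Φ : Sym2 V → ℕ}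
    (hΦ : ∀ e ∈ M, Φ e ∈ Finset.Icc 1 (k + 1))
    (hgood : ∀ e ∈ M, ∀ u ∈ e, G.GoodAt K c (Φ e) u) :
    ∃ c' : Sym2 V → ℕ, G.IsProperEC ∅ (k + 1) c' ∧ ∀ e ∈ M, c' e = Φ e := by
  classical
  have hnear : ∀ e ∈ M, ∀ f ∈ M, ∀ u ∈ e, ∀ v ∈ f, ∀ p : G.Walk u v, p.length < 5 → e = f := by
    intro e he f hf u hu v hv p hp
    by_contra hne
    have := hdist e he f hf hne u v hu hv p
    omega
  set T : Set (Sym2 V) := {f | ∃ e ∈ M, ∃ u ∈ e, u ∈ f ∧ c f = Φ e} with hT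
  have hM_ne : ∀ f ∈ M, ∀ g ∈ G.edgeSet, g ∉ M → ∀ v ∈ f, v ∈ g →
      Φ f ≠ if g ∈ K ∨ g ∈ T then k + 1 else c g := by
    intro f hf g hg hgM v hvf hvg
    have hgK : g ∉ K := fun h => hgM (hK.eq_of_mem (hMK hf) h hvf hvg ▸ hf)
    split_ifs with h
    · obtain ⟨e, he, u, hue, hug, hgu⟩ := h.resolve_left hgK
      obtain ⟨p, hp⟩ := exists_walk_length_le_one hg hvg hug
      rw [hnear f hf e he v hvf u hue p (by omega), ← hgu]
      have := (Finset.mem_Icc.1 (hc.1 g hg hgK)).2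
      omega
    · exact fun h' => h (Or.inr ⟨f, hf, v, hvf, hvg, h'.symm⟩)
  have hK_T : ∀ f ∈ K, f ∉ M → ∀ g ∈ G.edgeSet, g ∉ K → g ∈ T → ∀ v ∈ f, v ∉ g := by
    rintro f hf hfM g hg hgK ⟨e, he, u, hue, ⟨y, rfl⟩, hgu⟩ v hvf hvg
    rcases Sym2.mem_iff.1 hvg with rfl | rfl
    · exact hfM (hK.eq_of_mem (hMK he) hf hue hvf ▸ he)
    · exact hgood e he u hue v hg hgK hgu f hf hvf
  refine ⟨fun f => if f ∈ M then Φ f else if f ∈ K ∨ f ∈ T then k + 1 else c f, ⟨?_, ?_⟩,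
    fun e he => if_pos he⟩
  · intro f hf _
    dsimp only
    split_ifs with h₁ h₂
    · exact hΦ f h₁
    · simp
    · have := Finset.mem_Icc.1 (hc.1 f hf fun h => h₂ (Or.inl h))
      exact Finset.mem_Icc.2 ⟨this.1, this.2.trans (Nat.le_succ k)⟩
  · rintro f hf g hg - - hadj
    have hadj' := hadj
    obtain ⟨hne, v, hvf, hvg⟩ := hadj'
    dsimp only
    by_cases hfM : f ∈ M <;> by_cases hgM : g ∈ M
    · exact absurd (hK.eq_of_mem (hMK hfM) (hMK hgM) hvf hvg) hne
    · rw [if_pos hfM, if_neg hgM]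
      exact hM_ne f hfM g hg hgM v hvf hvg
    · rw [if_neg hfM, if_pos hgM]
      exact (hM_ne g hgM f hf hfM v hvg hvf).symm
    rw [if_neg hfM, if_neg hgM]
    split_ifs with h₁ h₂ h₂
    · exfalso
      by_cases hfK : f ∈ K <;> by_cases hgK : g ∈ K
      · exact hne (hK.eq_of_mem hfK hgK hvf hvg)
      · exact hK_T f hfK hfM g hg hgK (h₂.resolve_left hgK) v hvf hvg
      · exact hK_T g hgK hgM f hf hfK (h₁.resolve_left hfK) v hvg hvf
      · obtain ⟨e₁, he₁, u₁, hu₁, hu₁f, hf₁⟩ := h₁.resolve_left hfK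
        obtain ⟨e₂, he₂, u₂, hu₂, hu₂g, hg₂⟩ := h₂.resolve_left hgK
        obtain ⟨p, hp⟩ := exists_walk_length_le_one hf hu₁f hvf
        obtain ⟨q, hq⟩ := exists_walk_length_le_one hg hvg hu₂g
        have he : e₁ = e₂ := hnear e₁ he₁ e₂ he₂ u₁ hu₁ u₂ hu₂ (p.append q) (by
          rw [Walk.length_append]; omega)
        exact hc.2 f hf g hg hfK hgK hadj (by rw [hf₁, hg₂, he])
    · have := (Finset.mem_Icc.1 (hc.1 g hg fun h => h₂ (Or.inl h))).2
      omega
    · have := (Finset.mem_Icc.1 (hc.1 f hf fun h => h₁ (Or.inl h))).2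
      omega
    · exact hc.2 f hf g hg (fun h => h₁ (Or.inl h)) (fun h => h₂ (Or.inl h)) hadj

end Colouring

end SimpleGraph

/-- Simple-graph case of the C5-free theorem: in a simple graph with no
5-cycle, any precolouring from `{1, …, Δ + 1}` of a matching whose edges are
pairwise at distance at least `5` extends to a proper `(Δ + 1)`-edge-colouring. -/
theorem precolouring_extension_simple_c5free {V : Type} [Fintype V] [DecidableEq V]
    (G : SimpleGraph V) [DecidableRel G.Adj] (Δ : ℕ) (hΔ : ∀ v, G.degree v ≤ Δ)
    (hC5 : ¬ ∃ (v : V) (w : G.Walk v v), w.IsCycle ∧ w.length = 5)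
    (M : Set (Sym2 V)) (hM : G.IsMatchingSet M)
    (hdist : ∀ e ∈ M, ∀ f ∈ M, e ≠ f → G.EdgeDistGe e f 5)
    (Φ : Sym2 V → ℕ) (hΦ : ∀ e ∈ M, Φ e ∈ Finset.Icc 1 (Δ + 1)) :
    ∃ c : Sym2 V → ℕ, G.IsProperEC ∅ (Δ + 1) c ∧ ∀ e ∈ M, c e = Φ e := by
  obtain ⟨K, c, h, hgood⟩ := exists_isMinColouring_goodAt hΔ hC5 hM hdist Φ
  exact h.isProperEC.exists_extension h.isMatchingSet h.subset hdist hΦ hgood
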